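/- arXiv:2012.12604 — 12 statements merged into one kernel-verified Lean document; each statement's English description precedes it below -/
import Mathlib

section
/- Let π(1), …, π(n) be a path in G (pairwise distinct nodes with consecutive nodes adjacent) whose MPDPs are nondecreasing along the path, i.e., u_{π(1)}(0) ≤ u_{π(2)}(0) ≤ ⋯ ≤ u_{π(n)}(0). If x ∈ NE_ρ and x_{π(1)} > 0, then x_{π(k)} > 0 for every k ∈ {1,…,n}, and moreover u_{π(k)}(x_{π(k)}) = u_{π(1)}(x_{π(1)}) for every k. -/
/-- **Support and equal payoff density along a path with nondecreasing MPDPs.**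
Let `π 0, …, π n` be a path in `G` (pairwise distinct nodes, consecutive nodes
adjacent) whose MPDPs `a i = u i 0` are nondecreasing along the path.
If `x ∈ NE_ρ` and `x (π 0) > 0`, then every node on the path has positive mass
and the payoff densities along the path all equal that at `π 0`. -/
theorem nash_along_monotone_path {V : Type*} [Fintype V] [Nonempty V]
    (G : SimpleGraph V) (u : V → ℝ → ℝ) (hu : ∀ i, StrictAnti (u i))
    (ρ : ℝ) (hρ : 0 ≤ ρ) (x : V → ℝ)
    (hx0 : ∀ i, 0 ≤ x i) (hxsum : ∑ i, x i = ρ)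
    (hNE : ∀ i, 0 < x i → ∀ j, G.Adj i j → u j (x j) ≤ u i (x i))
    (n : ℕ) (π : Fin (n + 1) → V) (hinj : Function.Injective π)
    (hadj : ∀ k : Fin n, G.Adj (π k.castSucc) (π k.succ))
    (hmono : ∀ k l : Fin (n + 1), k ≤ l → u (π k) 0 ≤ u (π l) 0)
    (hpos : 0 < x (π 0)) :
    ∀ k : Fin (n + 1),
      0 < x (π k) ∧ u (π k) (x (π k)) = u (π 0) (x (π 0)) := by
  intro k
  induction k using Fin.induction with
  | zero => exact ⟨hpos, rfl⟩
  | succ k ih =>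
    obtain ⟨h1, h2⟩ := ih
    have h3 := hNE _ h1 _ (hadj k)
    have h4 := hmono k.castSucc k.succ (Fin.castSucc_lt_succ).le
    have h5 := hu (π k.castSucc) h1
    have h6 : 0 < x (π k.succ) := by
      rcases (hx0 (π k.succ)).lt_or_eq with h | h
      · exact h
      · rw [← h] at h3
        linarith
    exact ⟨h6, (le_antisymm h3 (hNE _ h6 _ (hadj k).symm)).trans h2⟩
end

section
/- Suppose G is a quasi-concave hill (QCH) and x ∈ NE_ρ. Then for all nodes i, j ∈ V with x_i > 0 and x_j > 0, one has u_i(x_i) = u_j(x_j). -/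
/-- A path in `G` from `i` to `j` (pairwise distinct nodes, consecutive nodes
adjacent) along which the values `a` are quasi-concave: for indices
`k ≤ m ≤ l`, `a (π m) ≥ min (a (π k)) (a (π l))`. -/
def IsQuasiConcavePath {V : Type*} (G : SimpleGraph V) (a : V → ℝ) (i j : V) : Prop :=
  ∃ n : ℕ, ∃ π : Fin (n + 1) → V,
    Function.Injective π ∧ π 0 = i ∧ π (Fin.last n) = j ∧
    (∀ k : Fin n, G.Adj (π k.castSucc) (π k.succ)) ∧
    (∀ k m l : Fin (n + 1), k ≤ m → m ≤ l → min (a (π k)) (a (π l)) ≤ a (π m))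

/-- `G` is a quasi-concave hill (QCH) with respect to the node values `a`:
between every two distinct nodes there is a path with quasi-concave values. -/
def IsQCH {V : Type*} (G : SimpleGraph V) (a : V → ℝ) : Prop :=
  ∀ i j : V, i ≠ j → IsQuasiConcavePath G a i j

/-- **Same payoff density across non-empty nodes at a Nash equilibrium in a QCH.**
If `G` is a QCH (w.r.t. the MPDPs `a i = u i 0`) and `x ∈ NE_ρ`, then any two
nodes with positive mass have equal payoff densities. -/
theorem nash_same_level_in_QCH {V : Type*} [Fintype V] [Nonempty V]
    (G : SimpleGraph V) (u : V → ℝ → ℝ) (hu : ∀ i, StrictAnti (u i))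
    (hQCH : IsQCH G (fun i => u i 0))
    (ρ : ℝ) (hρ : 0 ≤ ρ) (x : V → ℝ)
    (hx0 : ∀ i, 0 ≤ x i) (hxsum : ∑ i, x i = ρ)
    (hNE : ∀ i, 0 < x i → ∀ j, G.Adj i j → u j (x j) ≤ u i (x i))
    (i j : V) (hxi : 0 < x i) (hxj : 0 < x j) :
    u i (x i) = u j (x j) := by
  by_cases hij : i = j
  · rw [hij]
  obtain ⟨n, π, -, h0, hl, hadj, hqc⟩ := hQCH i j hij
  have hpos : ∀ k, 0 < x (π k) := by
    by_contra hcon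
    obtain ⟨k0, hk0⟩ := not_forall.mp hcon
    have hz : ∀ k, ¬ 0 < x (π k) → x (π k) = 0 := fun k hk =>
      le_antisymm (not_lt.mp hk) (hx0 _)
    obtain ⟨m, hm, hmin⟩ := Finset.exists_min_image
      (Finset.univ.filter (fun k => ¬ 0 < x (π k))) (fun k => u (π k) 0)
      ⟨k0, Finset.mem_filter.mpr ⟨Finset.mem_univ _, hk0⟩⟩
    have hm' := (Finset.mem_filter.mp hm).2
    have hmin' : ∀ k, ¬ 0 < x (π k) → u (π m) 0 ≤ u (π k) 0 := fun k hk =>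
      hmin k (Finset.mem_filter.mpr ⟨Finset.mem_univ _, hk⟩)
    have key : ∀ k l, G.Adj (π l) (π k) → 0 < x (π l) → ¬ 0 < x (π k) →
        u (π m) 0 < u (π l) 0 := by
      intro k l h1 h2 h3
      have h4 := hNE _ h2 _ h1
      rw [hz k h3] at h4
      exact lt_of_le_of_lt ((hmin' k h3).trans h4) (hu _ h2)
    have A : ∀ k, ¬ 0 < x (π k) → ∃ l, l ≤ k ∧ u (π m) 0 < u (π l) 0 := by
      intro k
      induction k using Fin.induction with
      | zero => intro h; rw [h0] at h; exact absurd hxi h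
      | succ k ih =>
        intro h
        have hle : k.castSucc ≤ k.succ := Fin.castSucc_lt_succ.le
        by_cases hp : 0 < x (π k.castSucc)
        · exact ⟨_, hle, key _ _ (hadj k) hp h⟩
        · obtain ⟨l, h1, h2⟩ := ih hp
          exact ⟨l, h1.trans hle, h2⟩
    have B : ∀ k, ¬ 0 < x (π k) → ∃ l, k ≤ l ∧ u (π m) 0 < u (π l) 0 := by
      intro k
      induction k using Fin.reverseInduction with
      | last => intro h; rw [hl] at h; exact absurd hxj h
      | cast k ih =>
        intro h
        have hle : k.castSucc ≤ k.succ := Fin.castSucc_lt_succ.le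
        by_cases hp : 0 < x (π k.succ)
        · exact ⟨_, hle, key _ _ (hadj k).symm hp h⟩
        · obtain ⟨l, h1, h2⟩ := ih hp
          exact ⟨l, hle.trans h1, h2⟩
    obtain ⟨k, hk, hk2⟩ := A m hm'
    obtain ⟨l, hl1, hl2⟩ := B m hm'
    exact absurd (hqc k m l hk hl1) (not_le.mpr (lt_min hk2 hl2))
  have hall : ∀ k, u i (x i) = u (π k) (x (π k)) := by
    intro k
    induction k using Fin.induction with
    | zero => rw [h0]
    | succ k ih =>
      rw [ih]
      exact le_antisymm (hNE _ (hpos _) _ (hadj k).symm) (hNE _ (hpos _) _ (hadj k))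
  rw [hall (Fin.last n), hl]
end

section
/- Suppose G is a quasi-concave hill (QCH) and x ∈ NE_ρ. Then for every node i with x_i > 0 and every node j ∈ V (whether or not j is adjacent to i, and whether or not x_j > 0), one has u_i(x_i) ≥ u_j(x_j). -/
/-- **Global payoff-density dominance of occupied nodes at a Nash equilibrium in a QCH.**
If `G` is a QCH (w.r.t. the MPDPs `a i = u i 0`) and `x ∈ NE_ρ`, then for every node
`i` with `x i > 0` and *every* node `j` (adjacent or not, occupied or not),
`u i (x i) ≥ u j (x j)`. -/
theorem nash_global_dominance_in_QCH {V : Type*} [Fintype V] [Nonempty V]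
    (G : SimpleGraph V) (u : V → ℝ → ℝ) (hu : ∀ i, StrictAnti (u i))
    (hQCH : IsQCH G (fun i => u i 0))
    (ρ : ℝ) (hρ : 0 ≤ ρ) (x : V → ℝ)
    (hx0 : ∀ i, 0 ≤ x i) (hxsum : ∑ i, x i = ρ)
    (hNE : ∀ i, 0 < x i → ∀ j, G.Adj i j → u j (x j) ≤ u i (x i))
    (i : V) (hxi : 0 < x i) (j : V) :
    u j (x j) ≤ u i (x i) := by
  by_contra hlt
  push Not at hlt
  have hij : i ≠ j := by
    rintro rfl
    exact lt_irrefl _ hlt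
  obtain ⟨n, π, -, h0, hl, hadj, hqc⟩ := hQCH i j hij
  have hai : u i (x i) < u i 0 := hu i hxi
  have haj : u i (x i) < u j 0 := lt_of_lt_of_le hlt ((hu j).antitone (hx0 j))
  have ha : ∀ m, u i (x i) < u (π m) 0 := by
    intro m
    have h := hqc 0 m (Fin.last n) (Fin.zero_le m) (Fin.le_last m)
    simp only [h0, hl] at h
    exact lt_of_lt_of_le (lt_min hai haj) h
  have key : ∀ m, 0 < x (π m) ∧ u (π m) (x (π m)) ≤ u i (x i) := by
    intro m
    induction m using Fin.induction with
    | zero => rw [h0]; exact ⟨hxi, le_rfl⟩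
    | succ k ih =>
      have h1 := (hNE _ ih.1 _ (hadj k)).trans ih.2
      refine ⟨lt_of_le_of_ne (hx0 _) ?_, h1⟩
      intro h
      rw [← h] at h1
      exact absurd (ha k.succ) (not_lt.mpr h1)
  have h := (key (Fin.last n)).2
  rw [hl] at h
  exact absurd hlt (not_lt.mpr h)
end

section
/- Suppose G is a quasi-concave hill (QCH), ρ ≥ 0, and x ∈ NE_ρ. Then x maximizes the social utility over the simplex: for every y ∈ S_ρ, U(y) ≤ U(x). -/
lemma tangent_aux {f : ℝ → ℝ} {d a : ℝ} (h : HasDerivAt f d a)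
    (hc : ConcaveOn ℝ Set.univ f) (b : ℝ) : f b - f a ≤ d * (b - a) := by
  rcases lt_trichotomy a b with hab | hab | hab
  · have := hc.slope_le_of_hasDerivAt (Set.mem_univ a) (Set.mem_univ b) hab h
    rw [slope_def_field, div_le_iff₀ (by linarith)] at this
    exact this
  · subst hab; simp
  · have := hc.le_slope_of_hasDerivAt (Set.mem_univ b) (Set.mem_univ a) hab h
    rw [slope_def_field, le_div_iff₀ (by linarith)] at this
    linarith

/-- **A Nash equilibrium in a QCH maximizes the social utility over the simplex.**
Here `p i` is differentiable and strictly concave with derivative `u i`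
(hence `u i` is strictly decreasing), the social utility is
`U x = ∑ i, (p i (x i) - p i 0)`, and `G` is a QCH w.r.t. the MPDPs `u i 0`. -/
theorem nash_maximizes_social_utility_in_QCH {V : Type*} [Fintype V] [Nonempty V]
    (G : SimpleGraph V) (p u : V → ℝ → ℝ)
    (hderiv : ∀ i y, HasDerivAt (p i) (u i y) y)
    (hconc : ∀ i, StrictConcaveOn ℝ Set.univ (p i))
    (hu : ∀ i, StrictAnti (u i))
    (hQCH : IsQCH G (fun i => u i 0))
    (ρ : ℝ) (hρ : 0 ≤ ρ) (x : V → ℝ)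
    (hx0 : ∀ i, 0 ≤ x i) (hxsum : ∑ i, x i = ρ)
    (hNE : ∀ i, 0 < x i → ∀ j, G.Adj i j → u j (x j) ≤ u i (x i))
    (y : V → ℝ) (hy0 : ∀ i, 0 ≤ y i) (hysum : ∑ i, y i = ρ) :
    ∑ i, (p i (y i) - p i 0) ≤ ∑ i, (p i (x i) - p i 0) := by
  have key : ∀ i, 0 < x i → ∀ j, u j (x j) ≤ u i (x i) := by
    intro i hi j
    by_cases hij : i = j
    · rw [hij]
    by_contra hlt
    push Not at hlt
    obtain ⟨n, π, -, h0, hn, hadj, hq⟩ := hQCH i j hij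
    have hai : u i (x i) < u i 0 := hu i hi
    have haj : u i (x i) < u j 0 := lt_of_lt_of_le hlt ((hu j).antitone (hx0 j))
    have ha : ∀ m, u i (x i) < u (π m) 0 := by
      intro m
      have h := hq 0 m (Fin.last n) (Fin.zero_le _) (Fin.le_last _)
      simp only [h0, hn] at h
      exact lt_of_lt_of_le (lt_min hai haj) h
    have hall : ∀ m : Fin (n + 1), u (π m) (x (π m)) ≤ u i (x i) := by
      intro m
      induction m using Fin.induction with
      | zero => rw [h0]
      | succ k ih =>
        have hpos : 0 < x (π k.castSucc) := by
          rcases (hx0 (π k.castSucc)).lt_or_eq with h | h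
          · exact h
          · have h1 := ha k.castSucc
            rw [← h] at ih
            linarith
        exact (hNE _ hpos _ (hadj k)).trans ih
    have := hall (Fin.last n)
    rw [hn] at this
    linarith
  by_cases hex : ∃ i, 0 < x i
  · obtain ⟨i, hi⟩ := hex
    have h1 : ∀ j, p j (y j) - p j (x j) ≤ u i (x i) * (y j - x j) := by
      intro j
      refine (tangent_aux (hderiv j (x j)) (hconc j).concaveOn (y j)).trans ?_
      rcases (hx0 j).lt_or_eq with h | h
      · rw [le_antisymm (key i hi j) (key j h i)]
      · have := hy0 j
        exact mul_le_mul_of_nonneg_right (key i hi j) (by linarith)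
    have h2 := Finset.sum_le_sum (fun j (_ : j ∈ Finset.univ) => h1 j)
    rw [← Finset.mul_sum] at h2
    simp only [Finset.sum_sub_distrib] at h2 ⊢
    rw [hxsum, hysum] at h2
    linarith
  · push Not at hex
    have hx : ∀ i, x i = 0 := fun i => le_antisymm (hex i) (hx0 i)
    have hr : ρ = 0 := by rw [← hxsum]; simp [hx]
    rw [hr, Finset.sum_eq_zero_iff_of_nonneg (fun i _ => hy0 i)] at hysum
    have hy : ∀ i, y i = 0 := fun i => hysum i (Finset.mem_univ i)
    simp [hx, hy]
end

section
/- Suppose G is a quasi-concave hill (QCH) and ρ ≥ 0. Then the stratified population game has a unique Nash equilibrium: if x ∈ NE_ρ and y ∈ NE_ρ, then x = y. -/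
theorem nash_global_aux {V : Type*} (G : SimpleGraph V) (u : V → ℝ → ℝ)
    (hu : ∀ i, StrictAnti (u i)) (hQCH : IsQCH G (fun i => u i 0)) (x : V → ℝ)
    (hx0 : ∀ i, 0 ≤ x i)
    (hxNE : ∀ i, 0 < x i → ∀ j, G.Adj i j → u j (x j) ≤ u i (x i))
    (i j : V) (hi : 0 < x i) : u j (x j) ≤ u i (x i) := by
  by_contra! hlt
  have hij : i ≠ j := by
    rintro rfl
    exact lt_irrefl _ hlt
  obtain ⟨n, π, -, h0, hn, hadj, hqc⟩ := hQCH i j hij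
  have hai : u i (x i) < u i 0 := hu i hi
  have haj : u i (x i) < u j 0 := lt_of_lt_of_le hlt ((hu j).antitone (hx0 j))
  have key : ∀ k : Fin (n + 1), u (π k) (x (π k)) ≤ u i (x i) := by
    intro k
    induction k using Fin.induction with
    | zero => rw [h0]
    | succ k ih =>
      have h1 := hqc 0 k.castSucc (Fin.last n) (Fin.zero_le _) (Fin.le_last _)
      simp only [h0, hn] at h1
      have h2 : u (π k.castSucc) (x (π k.castSucc)) < u (π k.castSucc) 0 :=
        lt_of_le_of_lt ih (lt_of_lt_of_le (lt_min hai haj) h1)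
      exact (hxNE _ ((hu _).lt_iff_gt.mp h2) _ (hadj k)).trans ih
  have := key (Fin.last n)
  rw [hn] at this
  exact absurd this (not_le.mpr hlt)

theorem nash_le_aux {V : Type*} [Fintype V] (x y : V → ℝ)
    (hs : ∑ i, x i = ∑ i, y i) (hne : x ≠ y) : ∃ i, x i < y i := by
  by_contra! h
  apply hne
  have := (Finset.sum_eq_sum_iff_of_le (fun i _ => h i)).mp hs.symm
  funext i
  exact (this i (Finset.mem_univ i)).symm

/-- **Uniqueness of the Nash equilibrium for a QCH.**
Here `p i` is differentiable and strictly concave with derivative `u i`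
(hence `u i` is strictly decreasing), and `G` is a QCH w.r.t. the MPDPs
`u i 0`. Any two Nash equilibria in the simplex `S_ρ` coincide. -/
theorem nash_unique_in_QCH {V : Type*} [Fintype V] [Nonempty V]
    (G : SimpleGraph V) (p u : V → ℝ → ℝ)
    (hderiv : ∀ i y, HasDerivAt (p i) (u i y) y)
    (hconc : ∀ i, StrictConcaveOn ℝ Set.univ (p i))
    (hu : ∀ i, StrictAnti (u i))
    (hQCH : IsQCH G (fun i => u i 0))
    (ρ : ℝ) (hρ : 0 ≤ ρ) (x y : V → ℝ)
    (hx0 : ∀ i, 0 ≤ x i) (hxsum : ∑ i, x i = ρ)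
    (hxNE : ∀ i, 0 < x i → ∀ j, G.Adj i j → u j (x j) ≤ u i (x i))
    (hy0 : ∀ i, 0 ≤ y i) (hysum : ∑ i, y i = ρ)
    (hyNE : ∀ i, 0 < y i → ∀ j, G.Adj i j → u j (y j) ≤ u i (y i)) :
    x = y := by
  by_contra hne
  have hs : ∑ i, x i = ∑ i, y i := hxsum.trans hysum.symm
  obtain ⟨j, hj⟩ := nash_le_aux x y hs hne
  obtain ⟨i, hi⟩ := nash_le_aux y x hs.symm (Ne.symm hne)
  have h1 := nash_global_aux G u hu hQCH x hx0 hxNE i j (lt_of_le_of_lt (hy0 i) hi)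
  have h2 := nash_global_aux G u hu hQCH y hy0 hyNE j i (lt_of_le_of_lt (hx0 j) hj)
  have h3 := hu i hi
  have h4 := hu j hj
  linarith
end

section
/- Let ρ ≥ 0 and suppose x ∈ S_ρ maximizes Σ_{i∈V} p_i(x_i) over the simplex S_ρ. Then for every node i with x_i > 0 and every node j ∈ V, u_i(x_i) ≥ u_j(x_j). In particular, for any simple undirected graph G on V, the maximizer x belongs to NE_ρ. -/
/-- **A maximizer of the total payoff over the simplex is a Nash equilibrium
for any graph.** Here `p i` is differentiable and strictly concave with
derivative `u i` (hence `u i` is strictly decreasing). If `x ∈ S_ρ` maximizes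
`∑ i, p i (x i)` over `S_ρ`, then for every node `i` with `x i > 0` and every
node `j`, `u i (x i) ≥ u j (x j)`; in particular, for every simple graph `G`
on `V`, `x` satisfies the Nash equilibrium condition. -/
theorem maximizer_is_nash {V : Type*} [Fintype V] [Nonempty V]
    (p u : V → ℝ → ℝ)
    (hderiv : ∀ i y, HasDerivAt (p i) (u i y) y)
    (hconc : ∀ i, StrictConcaveOn ℝ Set.univ (p i))
    (hu : ∀ i, StrictAnti (u i))
    (ρ : ℝ) (hρ : 0 ≤ ρ) (x : V → ℝ)
    (hx0 : ∀ i, 0 ≤ x i) (hxsum : ∑ i, x i = ρ)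
    (hmax : ∀ y : V → ℝ, (∀ i, 0 ≤ y i) → ∑ i, y i = ρ →
      ∑ i, p i (y i) ≤ ∑ i, p i (x i)) :
    (∀ i, 0 < x i → ∀ j, u j (x j) ≤ u i (x i)) ∧
    (∀ G : SimpleGraph V, ∀ i, 0 < x i → ∀ j, G.Adj i j →
      u j (x j) ≤ u i (x i)) := by
  classical
  have key : ∀ i, 0 < x i → ∀ j, u j (x j) ≤ u i (x i) := by
    intro i hi j
    by_cases hij : j = i
    · rw [hij]
    let d : V → ℝ := fun k => (if k = j then 1 else 0) - (if k = i then 1 else 0)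
    have hd : ∀ k, HasDerivAt (fun t : ℝ => p k (x k + t * d k)) (u k (x k) * d k) 0 := by
      intro k
      have h1 : HasDerivAt (fun t : ℝ => x k + t * d k) (d k) 0 := by
        simpa using ((hasDerivAt_id (0 : ℝ)).mul_const (d k)).const_add (x k)
      have h2 : HasDerivAt (p k) (u k (x k)) (x k + 0 * d k) := by
        simpa using hderiv k (x k)
      exact h2.comp (0 : ℝ) h1
    have hf : HasDerivAt (fun t : ℝ => ∑ k, p k (x k + t * d k)) (∑ k, u k (x k) * d k) 0 :=
      HasDerivAt.fun_sum (fun k _ => hd k)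
    have hsum : ∑ k, u k (x k) * d k = u j (x j) - u i (x i) := by
      simp [d, mul_sub, Finset.sum_sub_distrib]
    have hle : ∑ k, u k (x k) * d k ≤ 0 := by
      refine le_of_tendsto hf.tendsto_slope_zero_right ?_
      filter_upwards [Ioo_mem_nhdsGT hi] with t ht
      obtain ⟨ht0, ht1⟩ := ht
      have hm := hmax (fun k => x k + t * d k) (by
        intro k
        have hk := hx0 k
        by_cases h1 : k = i
        · subst h1
          have : d k = -1 := by simp [d, Ne.symm hij]
          simp only [this]
          linarith
        · have : 0 ≤ d k := by
            simp only [d, h1, if_false]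
            split_ifs <;> norm_num
          positivity) (by
        rw [Finset.sum_add_distrib, ← Finset.mul_sum, hxsum]
        simp [d, Finset.sum_sub_distrib])
      have h3 : ∑ k, p k (x k + (0 + t) * d k) - ∑ k, p k (x k + 0 * d k) ≤ 0 := by
        simpa using hm
      rw [smul_eq_mul]
      exact mul_nonpos_of_nonneg_of_nonpos (inv_nonneg.mpr ht0.le) h3
    linarith
  exact ⟨key, fun _ i hi j _ => key i hi j⟩
end

section
/- For every ρ ≥ 0 and every simple undirected graph G on the finite nonempty node set V, the set of Nash equilibria NE_ρ is nonempty. -/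
/-- **Non-emptiness of the set of Nash equilibria.** Here `p i` is
differentiable and strictly concave with derivative `u i` (hence `u i` is
strictly decreasing). For every `ρ ≥ 0` and every simple graph `G` on the
finite nonempty node set `V`, there is a point of the simplex `S_ρ`
satisfying the Nash equilibrium condition. -/
theorem nash_set_nonempty {V : Type*} [Fintype V] [Nonempty V]
    (G : SimpleGraph V) (p u : V → ℝ → ℝ)
    (hderiv : ∀ i y, HasDerivAt (p i) (u i y) y)
    (hconc : ∀ i, StrictConcaveOn ℝ Set.univ (p i))
    (hu : ∀ i, StrictAnti (u i))
    (ρ : ℝ) (hρ : 0 ≤ ρ) :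
    ∃ x : V → ℝ, (∀ i, 0 ≤ x i) ∧ ∑ i, x i = ρ ∧
      ∀ i, 0 < x i → ∀ j, G.Adj i j → u j (x j) ≤ u i (x i) := by
  classical
  let S : Set (V → ℝ) := {x | (∀ i, 0 ≤ x i) ∧ ∑ i, x i = ρ}
  have hS : IsCompact S := by
    refine IsCompact.of_isClosed_subset
      (isCompact_Icc : IsCompact (Set.Icc (fun _ : V => (0 : ℝ)) (fun _ => ρ))) ?_ ?_
    · have h1 : IsClosed {x : V → ℝ | ∀ i, 0 ≤ x i} := by
        simp only [Set.setOf_forall]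
        exact isClosed_iInter fun i => isClosed_le continuous_const (continuous_apply i)
      have h2 : IsClosed {x : V → ℝ | ∑ i, x i = ρ} :=
        isClosed_eq (by fun_prop) continuous_const
      exact h1.inter h2
    · rintro x ⟨h0, h1⟩
      refine ⟨fun i => h0 i, fun i => ?_⟩
      show x i ≤ ρ
      rw [← h1]
      exact Finset.single_le_sum (fun k _ => h0 k) (Finset.mem_univ i)
  have hne : S.Nonempty := by
    obtain ⟨v⟩ := ‹Nonempty V›
    refine ⟨Pi.single v ρ, fun i => ?_, by simp⟩
    by_cases h : i = v
    · subst h; simpa using hρ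
    · simp [h]
  have hp : ∀ i, Continuous (p i) := fun i =>
    continuous_iff_continuousAt.2 fun y => (hderiv i y).continuousAt
  have hcont : Continuous fun x : V → ℝ => ∑ i, p i (x i) :=
    continuous_finsetSum _ fun i _ => (hp i).comp (continuous_apply i)
  obtain ⟨x, ⟨hx0, hx1⟩, hmax⟩ := hS.exists_isMaxOn hne hcont.continuousOn
  refine ⟨x, hx0, hx1, fun i hi j hij => ?_⟩
  have hne' : i ≠ j := hij.ne
  let d : V → ℝ := fun k => (if k = j then 1 else 0) - (if k = i then 1 else 0)
  have hd : ∑ k, d k = 0 := by simp [d, Finset.sum_sub_distrib]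
  have hφ : HasDerivAt (fun t : ℝ => ∑ k, p k (x k + t * d k)) (u j (x j) - u i (x i)) 0 := by
    have h : HasDerivAt (fun t : ℝ => ∑ k, p k (x k + t * d k)) (∑ k, u k (x k) * d k) 0 := by
      refine HasDerivAt.fun_sum fun k _ => ?_
      have h1 : HasDerivAt (fun t : ℝ => x k + t * d k) (d k) 0 := by
        simpa using ((hasDerivAt_id (0 : ℝ)).mul_const (d k)).const_add (x k)
      have h2 : HasDerivAt (p k) (u k (x k)) (x k + 0 * d k) := by
        simpa using hderiv k (x k)
      exact h2.comp (0 : ℝ) h1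
    convert h using 1
    simp [d, mul_sub, Finset.sum_sub_distrib]
  have hle : u j (x j) - u i (x i) ≤ 0 := by
    refine le_of_tendsto hφ.tendsto_slope_zero_right ?_
    filter_upwards [Ioo_mem_nhdsGT hi] with t ht
    have hmem : (fun k => x k + t * d k) ∈ S := by
      refine ⟨fun k => ?_, ?_⟩
      · have := hx0 k
        have h1 := ht.1
        have h2 := ht.2
        by_cases hk : k = i
        · subst hk
          simp only [d, if_neg hne']
          simp
          linarith
        · simp only [d, if_neg hk]
          split_ifs <;> simp <;> linarith
      · rw [Finset.sum_add_distrib, ← Finset.mul_sum, hd, hx1]; simp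
    have h := hmax hmem
    simp only [Set.mem_setOf_eq] at h
    rw [smul_eq_mul]
    refine mul_nonpos_of_nonneg_of_nonpos (inv_nonneg.2 ht.1.le) ?_
    simpa using h
  linarith
end

section
/- Let i and j be two nodes, and let θ_i ≥ 0. Suppose x_i ∈ [0, θ_i], x_j ≥ 0, and u_i(θ_i) ≥ u_j(0). Then the stratified Smith dynamics flow from i to j vanishes: for every y ∈ [0, x_i], max(0, u_j(x_j)·(x_i − y) − (p_i(x_i) − p_i(y))) = 0. -/
/-- **Vanishing of the stratified Smith dynamics flow from `i` to `j`.**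
Here `pi, pj` are differentiable strictly concave cumulative payoff functions
with derivatives `ui, uj` (hence strictly decreasing payoff densities).
If `0 ≤ xi ≤ θ`, `xj ≥ 0` and `ui θ ≥ uj 0`, then for every `y ∈ [0, xi]`
(in particular for the clamped point `y_ij` used in SSD),
`max 0 (uj xj * (xi − y) − (pi xi − pi y)) = 0`. -/
theorem ssd_flow_vanishes
    (pi pj ui uj : ℝ → ℝ)
    (hdi : ∀ y, HasDerivAt pi (ui y) y)
    (hdj : ∀ y, HasDerivAt pj (uj y) y)
    (hci : StrictConcaveOn ℝ Set.univ pi)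
    (hcj : StrictConcaveOn ℝ Set.univ pj)
    (hui : StrictAnti ui) (huj : StrictAnti uj)
    (θ xi xj : ℝ) (hθ : 0 ≤ θ)
    (hxi0 : 0 ≤ xi) (hxiθ : xi ≤ θ) (hxj : 0 ≤ xj)
    (hpayoff : uj 0 ≤ ui θ) :
    ∀ y : ℝ, 0 ≤ y → y ≤ xi →
      max 0 (uj xj * (xi - y) - (pi xi - pi y)) = 0 := by
  intro y hy0 hyx
  apply max_eq_left
  rcases hyx.eq_or_lt with h | h
  · subst h
    simp
  · have h1 := hci.concaveOn.le_slope_of_hasDerivAt (Set.mem_univ y) (Set.mem_univ xi) h (hdi xi)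
    rw [slope_def_field, le_div_iff₀ (by linarith)] at h1
    have h2 : uj xj ≤ ui xi :=
      (huj.antitone hxj).trans (hpayoff.trans (hui.antitone hxiθ))
    have h3 := mul_le_mul_of_nonneg_right h2 (sub_nonneg.2 h.le)
    linarith
end

section
/- Suppose G is a quasi-concave hill (QCH), ρ ≥ 0, and x ∈ NE_ρ. Let M := {j ∈ V | x_j = 0} and suppose M is nonempty, and set a_max := max_{j ∈ M} u_j(0). Suppose that for each i ∈ V \ M there is y_i ∈ ℝ with u_i(y_i) = a_max. Then x_i ≤ y_i for every i ∈ V \ M, and consequently ρ = Σ_{i∈V} x_i ≤ Σ_{i ∈ V \ M} y_i. -/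
/-- **Upper bound on the population mass at a Nash equilibrium in a QCH with
empty nodes.** Let `G` be a QCH (w.r.t. the MPDPs `u i 0`) and `x ∈ NE_ρ`.
Let `M = {j | x j = 0}` be nonempty, `amax = max_{j ∈ M} u j 0`, and suppose
for each `i ∉ M` there is `y i` with `u i (y i) = amax`. Then `x i ≤ y i` for
every `i ∉ M`, and consequently `ρ ≤ ∑_{i ∉ M} y i`. -/
theorem nash_mass_upper_bound_in_QCH {V : Type*} [Fintype V] [Nonempty V]
    [DecidableEq V]
    (G : SimpleGraph V) (u : V → ℝ → ℝ) (hu : ∀ i, StrictAnti (u i))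
    (hQCH : IsQCH G (fun i => u i 0))
    (ρ : ℝ) (hρ : 0 ≤ ρ) (x : V → ℝ)
    (hx0 : ∀ i, 0 ≤ x i) (hxsum : ∑ i, x i = ρ)
    (hNE : ∀ i, 0 < x i → ∀ j, G.Adj i j → u j (x j) ≤ u i (x i))
    (M : Finset V) (hMmem : ∀ j, j ∈ M ↔ x j = 0) (hMne : M.Nonempty)
    (amax : ℝ) (hamax : amax = M.sup' hMne (fun j => u j 0))
    (y : V → ℝ) (hy : ∀ i ∉ M, u i (y i) = amax) :
    (∀ i ∉ M, x i ≤ y i) ∧ ρ ≤ ∑ i ∈ Finset.univ \ M, y i := by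
  have key : ∀ i ∉ M, amax ≤ u i (x i) := by
    intro i hi
    obtain ⟨j, hj, hja⟩ := Finset.exists_mem_eq_sup' hMne (fun j => u j 0)
    have hja' : amax = u j 0 := hamax.trans hja
    have hxi : 0 < x i := lt_of_le_of_ne (hx0 i) (fun h => hi ((hMmem i).2 h.symm))
    have hij : i ≠ j := fun h => hi (h ▸ hj)
    by_contra hlt
    rw [not_le] at hlt
    obtain ⟨n, π, -, h0, hl, hadj, hqc⟩ := hQCH i j hij
    have hind : ∀ k : Fin (n + 1), 0 < x (π k) ∧ u (π k) (x (π k)) ≤ u i (x i) := by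
      intro k
      induction k using Fin.induction with
      | zero => rw [h0]; exact ⟨hxi, le_rfl⟩
      | succ k ih =>
        have h1 : u (π k.succ) (x (π k.succ)) ≤ u i (x i) :=
          (hNE _ ih.1 _ (hadj k)).trans ih.2
        refine ⟨lt_of_le_of_ne (hx0 _) (fun h => ?_), h1⟩
        rw [← h] at h1
        have h2 := hqc 0 k.succ (Fin.last n) (Fin.zero_le _) (Fin.le_last _)
        simp only [h0, hl] at h2
        have h3 : u i (x i) < u i 0 := hu i hxi
        have h4 : u i (x i) < min (u i 0) (u j 0) := lt_min h3 (hja' ▸ hlt)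
        linarith
    have h5 := (hind (Fin.last n)).1
    rw [hl, (hMmem j).1 hj] at h5
    exact lt_irrefl _ h5
  have main : ∀ i ∉ M, x i ≤ y i := by
    intro i hi
    have h := key i hi
    rw [← hy i hi] at h
    exact (hu i).le_iff_ge.1 h
  refine ⟨main, ?_⟩
  have hM : ∑ i ∈ M, x i = 0 := Finset.sum_eq_zero (fun i hi => (hMmem i).1 hi)
  have hs := Finset.sum_sdiff (f := x) (Finset.subset_univ M)
  have hle : ∑ i ∈ Finset.univ \ M, x i ≤ ∑ i ∈ Finset.univ \ M, y i :=
    Finset.sum_le_sum (fun i hi => main i (Finset.mem_sdiff.1 hi).2)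
  linarith
end

section
/- Let x ∈ S_ρ and let (z*, d*) be an optimal solution of problem P3. Then for every ordered pair (i,j) with i ≠ j, j adjacent to i in G, and d*_{ij} > 0, one has u_j(z*_j) ≥ u_i(z*_i). -/
open Finset

/-- The closed neighborhood of node `i` in `G`, as a `Finset`. -/
def closedNbhd {V : Type*} [Fintype V] [DecidableEq V]
    (G : SimpleGraph V) [DecidableRel G.Adj] (i : V) : Finset V :=
  insert i (G.neighborFinset i)

/-- Feasibility of a pair `(z, d)` for problem `P3` with population state `x`:
`d i j ≥ 0` for every `j` in the closed neighborhood `N̄(i)` of `i`,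
`∑_{j ∈ N̄(i)} d i j = x i` for every node `i`, and
`z i = x i + ∑_{j ∈ N̄(i)} (d j i − d i j)` for every node `i`. -/
def P3Feasible {V : Type*} [Fintype V] [DecidableEq V]
    (G : SimpleGraph V) [DecidableRel G.Adj]
    (x z : V → ℝ) (d : V → V → ℝ) : Prop :=
  (∀ i : V, ∀ j ∈ closedNbhd G i, 0 ≤ d i j) ∧
  (∀ i : V, ∑ j ∈ closedNbhd G i, d i j = x i) ∧
  (∀ i : V, z i = x i + ∑ j ∈ closedNbhd G i, (d j i - d i j))

/-- **Properties of optimizers of `P3`.** Here `p i` is differentiable and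
strictly concave with derivative `u i`. If `(z*, d*)` is an optimal solution
of `P3` for `x ∈ S_ρ`, then for every arc `(i, j)` of `G` with positive flow
`d* i j > 0`, one has `u j (z* j) ≥ u i (z* i)`. -/
theorem P3_optimal_flow_order {V : Type*} [Fintype V] [Nonempty V] [DecidableEq V]
    (G : SimpleGraph V) [DecidableRel G.Adj]
    (p u : V → ℝ → ℝ)
    (hderiv : ∀ i y, HasDerivAt (p i) (u i y) y)
    (hconc : ∀ i, StrictConcaveOn ℝ Set.univ (p i))
    (ρ : ℝ) (hρ : 0 ≤ ρ) (x : V → ℝ)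
    (hx0 : ∀ i, 0 ≤ x i) (hxsum : ∑ i, x i = ρ)
    (zs : V → ℝ) (ds : V → V → ℝ)
    (hfeas : P3Feasible G x zs ds)
    (hopt : ∀ z : V → ℝ, ∀ d : V → V → ℝ, P3Feasible G x z d →
      ∑ i, (p i (z i) - p i 0) ≤ ∑ i, (p i (zs i) - p i 0))
    (i j : V) (hne : i ≠ j) (hadj : G.Adj i j) (hd : 0 < ds i j) :
    u i (zs i) ≤ u j (zs j) := by
  obtain ⟨h1, h2, h3⟩ := hfeas
  set c : V → ℝ := fun k => (if k = i then 1 else 0) - (if k = j then 1 else 0) with hc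
  have hji : j ≠ i := hne.symm
  have hmem : ∀ a, c a ≠ 0 → i ∈ closedNbhd G a := by
    intro a ha
    by_cases hai : a = i
    · subst hai; simp [closedNbhd]
    · by_cases haj : a = j
      · subst haj; simp [closedNbhd, hadj.symm]
      · simp [hc, hai, haj] at ha
  have hii : i ∈ closedNbhd G i := by simp [closedNbhd]
  have hij : j ∈ closedNbhd G i := by simp [closedNbhd, hadj]
  have hcsum : ∀ a, ∑ b ∈ closedNbhd G a, (if a = i then c b else 0) = 0 := by
    intro a
    by_cases hai : a = i
    · subst hai
      simp [hc, Finset.sum_sub_distrib, hii, hij]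
    · simp [hai]
  have hcsum' : ∀ a, ∑ b ∈ closedNbhd G a, (if b = i then c a else 0) = c a := by
    intro a
    rw [Finset.sum_ite_eq']
    by_cases h0 : c a = 0
    · simp [h0]
    · simp [hmem a h0]
  have key : ∀ t : ℝ, 0 ≤ t → t ≤ ds i j →
      ∑ k, (p k (zs k + t * c k) - p k 0) ≤ ∑ k, (p k (zs k) - p k 0) := by
    intro t ht0 ht
    refine hopt (fun k => zs k + t * c k) (fun a b => ds a b + t * (if a = i then c b else 0))
      ⟨?_, ?_, ?_⟩
    · intro a b hb
      have hab := h1 a b hb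
      by_cases hai : a = i
      · subst hai
        by_cases hbj : b = j
        · subst hbj
          simp [hc, hji]; linarith
        · by_cases hba : b = a
          · subst hba; simp [hc, hne]; linarith
          · simp [hc, hbj, hba, hab]
      · simp [hai, hab]
    · intro a
      rw [Finset.sum_add_distrib, ← Finset.mul_sum, hcsum, h2]; ring
    · intro a
      have e : ∀ b, (ds b a + t * (if b = i then c a else 0)) -
          (ds a b + t * (if a = i then c b else 0)) = (ds b a - ds a b) +
          (t * (if b = i then c a else 0) - t * (if a = i then c b else 0)) := by
        intro b; ring
      simp only [e]
      rw [h3 a]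
      simp only [Finset.sum_add_distrib, Finset.sum_sub_distrib, ← Finset.mul_sum,
        hcsum, hcsum']
      ring
  have hD : HasDerivAt (fun t : ℝ => ∑ k, (p k (zs k + t * c k) - p k 0))
      (∑ k, u k (zs k) * c k) 0 := by
    refine HasDerivAt.fun_sum fun k _ => ?_
    have hl : HasDerivAt (fun t : ℝ => zs k + t * c k) (c k) 0 := by
      simpa using ((hasDerivAt_id (0 : ℝ)).mul_const (c k)).const_add (zs k)
    have hp : HasDerivAt (p k) (u k (zs k)) (zs k + 0 * c k) := by
      simpa using hderiv k (zs k)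
    exact (HasDerivAt.comp (0 : ℝ) hp hl).sub_const _
  have hval : ∑ k, u k (zs k) * c k = u i (zs i) - u j (zs j) := by
    simp [hc, mul_sub, Finset.sum_sub_distrib]
  have hT := hD.tendsto_slope_zero_right
  have hle : ∑ k, u k (zs k) * c k ≤ 0 := by
    refine le_of_tendsto hT ?_
    filter_upwards [Ioc_mem_nhdsGT hd] with t ht
    have := key t ht.1.le ht.2
    have hpos : 0 ≤ t⁻¹ := inv_nonneg.mpr ht.1.le
    simp only [zero_add, zero_mul, add_zero, smul_eq_mul]
    exact mul_nonpos_of_nonneg_of_nonpos hpos (by linarith)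
  linarith
end

section
/- Let x ∈ S_ρ, let (z*, d*) be an optimal solution of problem P3, let i ≠ j with j adjacent to i in G, and let θ_i ≥ 0 be such that z*_i ∈ [0, θ_i] and u_i(θ_i) ≥ u_j(0). Then d*_{ij} = 0. -/
open Finset

/-- **Flow removal condition for NRPM.** Here `p i` is differentiable and
strictly concave with derivative `u i` (hence `u i` is strictly decreasing).
Let `(z*, d*)` be an optimal solution of `P3` for `x ∈ S_ρ`, let `i ≠ j` be
adjacent in `G`, and let `θi ≥ 0` be such that `z* i ∈ [0, θi]` and
`u i θi ≥ u j 0`. Then `d* i j = 0`. -/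
theorem P3_optimal_flow_zero {V : Type*} [Fintype V] [Nonempty V] [DecidableEq V]
    (G : SimpleGraph V) [DecidableRel G.Adj]
    (p u : V → ℝ → ℝ)
    (hderiv : ∀ i y, HasDerivAt (p i) (u i y) y)
    (hconc : ∀ i, StrictConcaveOn ℝ Set.univ (p i))
    (hu : ∀ i, StrictAnti (u i))
    (ρ : ℝ) (hρ : 0 ≤ ρ) (x : V → ℝ)
    (hx0 : ∀ i, 0 ≤ x i) (hxsum : ∑ i, x i = ρ)
    (zs : V → ℝ) (ds : V → V → ℝ)
    (hfeas : P3Feasible G x zs ds)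
    (hopt : ∀ z : V → ℝ, ∀ d : V → V → ℝ, P3Feasible G x z d →
      ∑ i, (p i (z i) - p i 0) ≤ ∑ i, (p i (zs i) - p i 0))
    (i j : V) (hne : i ≠ j) (hadj : G.Adj i j)
    (θi : ℝ) (hθi : 0 ≤ θi) (hz0 : 0 ≤ zs i) (hzθ : zs i ≤ θi)
    (harc : u j 0 ≤ u i θi) :
    ds i j = 0 := by
  obtain ⟨hd0, hdx, hz⟩ := hfeas
  have hjN : j ∈ closedNbhd G i := by simp [closedNbhd, hadj]
  have hiN : i ∈ closedNbhd G j := by simp [closedNbhd, hadj.symm]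
  have hself : ∀ k, k ∈ closedNbhd G k := fun k => by simp [closedNbhd]
  have hsymm : ∀ a b, a ∈ closedNbhd G b → b ∈ closedNbhd G a := by
    intro a b h
    simp only [closedNbhd, Finset.mem_insert, SimpleGraph.mem_neighborFinset] at h ⊢
    rcases h with h | h
    · exact Or.inl h.symm
    · exact Or.inr h.symm
  by_contra hcon
  have hpos : 0 < ds i j := lt_of_le_of_ne (hd0 i j hjN) (Ne.symm hcon)
  have hzj : 0 < zs j := by
    have h1 : zs j = ∑ l ∈ closedNbhd G j, ds l j := by
      rw [hz j, Finset.sum_sub_distrib, hdx j]; ring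
    rw [h1]
    exact lt_of_lt_of_le hpos (Finset.single_le_sum (f := fun l => ds l j)
      (fun l hl => hd0 l j (hsymm l j hl)) hiN)
  have hlt : 0 < u i (zs i) - u j (zs j) := by
    have h1 := hu j hzj
    have h2 := (hu i).antitone hzθ
    linarith
  have hder : HasDerivAt (fun t : ℝ => p i (zs i + t) + p j (zs j - t))
      (u i (zs i) - u j (zs j)) 0 := by
    have h1 : HasDerivAt (fun t : ℝ => p i (zs i + t)) (u i (zs i)) 0 := by
      apply HasDerivAt.comp_const_add
      simpa using hderiv i (zs i)
    have h2 : HasDerivAt (fun t : ℝ => p j (zs j - t)) (-u j (zs j)) 0 := by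
      apply HasDerivAt.comp_const_sub
      simpa using hderiv j (zs j)
    exact h1.add h2
  obtain ⟨t, ht, ht0, htd⟩ : ∃ t : ℝ,
      p i (zs i) + p j (zs j) < p i (zs i + t) + p j (zs j - t) ∧ 0 < t ∧ t < ds i j := by
    rw [hasDerivAt_iff_tendsto_slope] at hder
    have h1 := (hder.eventually (Ioi_mem_nhds hlt)).filter_mono
      (nhdsWithin_mono (0:ℝ) (fun y (hy : y ∈ Set.Ioi (0:ℝ)) => ne_of_gt hy))
    obtain ⟨t, h3, h4, h5⟩ := (h1.and (Ioo_mem_nhdsGT hpos)).exists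
    refine ⟨t, ?_, h4, h5⟩
    have h6 : 0 < slope (fun t : ℝ => p i (zs i + t) + p j (zs j - t)) 0 t := h3
    rw [slope_def_field, div_pos_iff_of_pos_right (by linarith)] at h6
    simpa using h6
  have hw : ∀ k, ∑ l ∈ closedNbhd G k, (if k = i then
      (if l = i then t else 0) - (if l = j then t else 0) else 0) = 0 := by
    intro k
    by_cases hk : k = i
    · subst hk
      simp [Finset.sum_sub_distrib, hself, hjN]
    · simp [hk]
  have hw2 : ∀ k, ∑ l ∈ closedNbhd G k, (if l = i then
      (if k = i then t else 0) - (if k = j then t else 0) else 0)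
      = (if k = i then t else 0) - (if k = j then t else 0) := by
    intro k
    rw [Finset.sum_ite_eq']
    by_cases hk : k = i
    · subst hk; simp [hself]
    · by_cases hk' : k = j
      · subst hk'; simp [hiN]
      · simp [hk, hk']
  have := hopt (fun k => zs k + ((if k = i then t else 0) - (if k = j then t else 0)))
    (fun a b => ds a b + (if a = i then
      (if b = i then t else 0) - (if b = j then t else 0) else 0)) ⟨?_, ?_, ?_⟩
  · rw [← sub_nonpos, ← Finset.sum_sub_distrib] at this
    rw [Finset.sum_eq_add_of_mem i j (Finset.mem_univ _) (Finset.mem_univ _) hne] at this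
    · simp [hne, hne.symm, ← sub_eq_add_neg] at this
      linarith
    · rintro k - ⟨h1, h2⟩
      simp [h1, h2]
  · intro a b hb
    have := hd0 a b hb
    by_cases ha : a = i
    · subst ha
      by_cases hb' : b = j
      · subst hb'
        simp [hne.symm]; linarith
      · simp only [hb', if_true, if_false]
        split_ifs <;> linarith
    · simpa [ha] using this
  · intro k
    rw [Finset.sum_add_distrib, hw, hdx, add_zero]
  · intro k
    have h1 := hz k
    rw [Finset.sum_sub_distrib] at h1 ⊢
    rw [Finset.sum_add_distrib, Finset.sum_add_distrib, hw, hw2]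
    linarith
end

section
/- Let x ∈ S_ρ. Then x ∈ NE_ρ if and only if the trivial pair (z, d) with z = x, d_{ii} = x_i for all i, and d_{ij} = 0 for all i ≠ j is an optimal solution of problem P3, i.e., if and only if Σ_{i∈V} p_i(z_i) ≤ Σ_{i∈V} p_i(x_i) for every feasible pair (z, d) of P3. -/
open Finset

lemma mem_closedNbhd' {V : Type*} [Fintype V] [DecidableEq V]
    (G : SimpleGraph V) [DecidableRel G.Adj] (i j : V) :
    j ∈ closedNbhd G i ↔ j = i ∨ G.Adj i j := by
  simp [closedNbhd]

lemma tangent_le {f : ℝ → ℝ} (hf : StrictConcaveOn ℝ Set.univ f) {x c : ℝ}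
    (h : HasDerivAt f c x) (y : ℝ) : f y ≤ f x + c * (y - x) := by
  rcases lt_trichotomy x y with hxy | hxy | hxy
  · have := hf.concaveOn.slope_le_of_hasDerivAt (Set.mem_univ x) (Set.mem_univ y) hxy h
    rw [slope_def_field, div_le_iff₀ (by linarith)] at this
    linarith
  · subst hxy; simp
  · have := hf.concaveOn.le_slope_of_hasDerivAt (Set.mem_univ y) (Set.mem_univ x) hxy h
    rw [slope_def_field, le_div_iff₀ (by linarith)] at this
    linarith

lemma swap_nbhd {V : Type*} [Fintype V] [DecidableEq V]
    (G : SimpleGraph V) [DecidableRel G.Adj] (F : V → V → ℝ) :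
    ∑ i, ∑ j ∈ closedNbhd G i, F i j = ∑ i, ∑ j ∈ closedNbhd G i, F j i := by
  apply Finset.sum_comm'
  intro i j
  simp only [mem_closedNbhd', G.adj_comm i j, Finset.mem_univ, true_and, and_true]
  constructor <;> rintro (h | h) <;> simp [h]

/-- **`x` is a Nash equilibrium iff the trivial pair is optimal for `P3`.**
Here `p i` is continuously differentiable and strictly concave with derivative
`u i` (hence `u i` is continuous and strictly decreasing). For `x ∈ S_ρ`,
the Nash equilibrium condition holds at `x` if and only if the trivial pair
`(z, d)` with `z = x`, `d i i = x i` and `d i j = 0` for `i ≠ j` is an optimal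
solution of `P3`, i.e. iff `∑ i, p i (z i) ≤ ∑ i, p i (x i)` for every
feasible pair `(z, d)` of `P3`. -/
theorem nash_iff_trivial_optimal_P3 {V : Type*} [Fintype V] [Nonempty V]
    [DecidableEq V]
    (G : SimpleGraph V) [DecidableRel G.Adj]
    (p u : V → ℝ → ℝ)
    (hderiv : ∀ i y, HasDerivAt (p i) (u i y) y)
    (hcont : ∀ i, Continuous (u i))
    (hconc : ∀ i, StrictConcaveOn ℝ Set.univ (p i))
    (hu : ∀ i, StrictAnti (u i))
    (ρ : ℝ) (hρ : 0 ≤ ρ) (x : V → ℝ)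
    (hx0 : ∀ i, 0 ≤ x i) (hxsum : ∑ i, x i = ρ) :
    (∀ i, 0 < x i → ∀ j, G.Adj i j → u j (x j) ≤ u i (x i))
      ↔ (∀ z : V → ℝ, ∀ d : V → V → ℝ, P3Feasible G x z d →
          ∑ i, p i (z i) ≤ ∑ i, p i (x i)) := by
  constructor
  · rintro hN z d ⟨hd0, hd1, hd2⟩
    have h1 : ∑ i, p i (z i) ≤ ∑ i, (p i (x i) + u i (x i) * (z i - x i)) :=
      Finset.sum_le_sum fun i _ => tangent_le (hconc i) (hderiv i (x i)) (z i)
    rw [Finset.sum_add_distrib] at h1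
    have h2 : ∑ i, u i (x i) * (z i - x i)
        = ∑ i, ∑ j ∈ closedNbhd G i, (u j (x j) - u i (x i)) * d i j := by
      have h3 : ∀ i, u i (x i) * (z i - x i) = ∑ j ∈ closedNbhd G i, u i (x i) * d j i
          - ∑ j ∈ closedNbhd G i, u i (x i) * d i j := by
        intro i
        rw [hd2 i, add_sub_cancel_left, Finset.mul_sum, ← Finset.sum_sub_distrib]
        exact Finset.sum_congr rfl fun j _ => by ring
      simp only [h3, sub_mul, Finset.sum_sub_distrib]
      rw [swap_nbhd G (fun i j => u i (x i) * d j i)]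
    have h4 : ∑ i, ∑ j ∈ closedNbhd G i, (u j (x j) - u i (x i)) * d i j ≤ 0 := by
      refine Finset.sum_nonpos fun i _ => Finset.sum_nonpos fun j hj => ?_
      rcases (hd0 i j hj).eq_or_lt with h | h
      · simp [← h]
      · have hxi : 0 < x i := by
          rw [← hd1 i]
          exact h.trans_le (Finset.single_le_sum (f := fun j => d i j) (hd0 i) hj)
        rcases (mem_closedNbhd' G i j).1 hj with e | e
        · subst e; simp
        · exact mul_nonpos_of_nonpos_of_nonneg (by linarith [hN i hxi j e]) h.le
    linarith
  · intro hopt a ha b hab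
    by_contra! hlt
    have hne : a ≠ b := hab.ne
    have hev : ∀ᶠ e in nhdsWithin (0 : ℝ) (Set.Ioi 0),
        u a (x a - e) < u b (x b + e) ∧ e < x a ∧ 0 < e := by
      refine Filter.Eventually.and (nhdsWithin_le_nhds ?_)
        (Filter.Eventually.and (nhdsWithin_le_nhds (gt_mem_nhds ha)) self_mem_nhdsWithin)
      have c1 : Continuous fun e : ℝ => u a (x a - e) := (hcont a).comp (by fun_prop)
      have c2 : Continuous fun e : ℝ => u b (x b + e) := (hcont b).comp (by fun_prop)
      exact (c1.continuousAt.eventually_lt c2.continuousAt (by simpa using hlt))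
    obtain ⟨e, he1, he2, he3⟩ := hev.exists
    let d : V → V → ℝ := fun i j => (if i = j then x i else 0) +
      if i = a then (if j = b then e else 0) - (if j = a then e else 0) else 0
    let w : V → ℝ := fun i => (if i = b then e else 0) - (if i = a then e else 0)
    have hself : ∀ i, i ∈ closedNbhd G i := fun i => (mem_closedNbhd' G i i).2 (Or.inl rfl)
    have hb : b ∈ closedNbhd G a := (mem_closedNbhd' G a b).2 (Or.inr hab)
    have hb' : a ∈ closedNbhd G b := (mem_closedNbhd' G b a).2 (Or.inr hab.symm)
    have hs1 : ∀ i, ∑ j ∈ closedNbhd G i, d i j = x i := by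
      intro i
      simp only [d, Finset.sum_add_distrib, Finset.sum_ite_eq, hself, if_true]
      by_cases h : i = a
      · subst h
        simp [hself, hb]
      · simp [h]
    have hs2 : ∀ i, ∑ j ∈ closedNbhd G i, d j i = x i + w i := by
      intro i
      simp only [d, w, Finset.sum_add_distrib, Finset.sum_ite_eq', hself, if_true]
      by_cases h : i = a
      · subst h
        simp [hself]
      · by_cases h' : i = b
        · subst h'
          simp [hb']
        · simp [h, h']
    have hfeas : P3Feasible G x (fun i => x i + w i) d := by
      refine ⟨?_, hs1, ?_⟩
      · intro i j _
        have := hx0 i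
        simp only [d]
        split_ifs <;> subst_vars <;> first | linarith | simp_all
      · intro i
        rw [Finset.sum_sub_distrib, hs1, hs2]; ring
    have hle := hopt _ _ hfeas
    have hterm : ∀ i, u i (x i + w i) * w i ≤ p i (x i + w i) - p i (x i) := by
      intro i
      have := tangent_le (hconc i) (hderiv i (x i + w i)) (x i)
      linarith
    have hsum := Finset.sum_le_sum fun i (_ : i ∈ Finset.univ) => hterm i
    rw [Finset.sum_sub_distrib] at hsum
    have hval : ∑ i, u i (x i + w i) * w i = u b (x b + e) * e - u a (x a - e) * e := by
      have : ∀ i, u i (x i + w i) * w i = (if i = b then u b (x b + e) * e else 0)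
          - (if i = a then u a (x a - e) * e else 0) := by
        intro i
        by_cases h : i = a
        · subst h
          simp [w, hne, sub_eq_add_neg]
        · by_cases h' : i = b
          · subst h'
            simp [w, h]
          · simp [w, h, h']
      simp only [this, Finset.sum_sub_distrib, Finset.sum_ite_eq', Finset.mem_univ, if_true]
    have := mul_lt_mul_of_pos_right he1 he3
    linarith
end
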